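/- Let E be a geodesic metric space with convex metric and let X be a nonempty, bounded and convex subset of E. For r>0 and x'∈E with dist(x',X) ≥ r define C_n = cō(X ∪ {x'}) ∖ ⋃_{x∈X} B(x, dist(x',X) − 1/n). Then the sequence (diam C_n)_{n∈ℕ} converges to 0 uniformly with respect to x'∈E with dist(x',X) ≥ r; that is, for every r>0 and ε>0 there is n₀∈ℕ such that diam C_n < ε for all n ≥ n₀ and all x'∈E with dist(x',X) ≥ r. -/

import Mathlib

open Metric Set Filter Bornology

noncomputable section

/-- A geodesic path of length `l`: a map `c : ℝ → E` that is isometric on `[0, l]`. -/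
def IsGeodesicPath {E : Type*} [MetricSpace E] (c : ℝ → E) (l : ℝ) : Prop :=
  0 ≤ l ∧ ∀ s ∈ Icc (0:ℝ) l, ∀ t ∈ Icc (0:ℝ) l, dist (c s) (c t) = |s - t|

/-- `S` is a geodesic segment joining `x` and `y`. -/
def IsGeodesicSegment {E : Type*} [MetricSpace E] (S : Set E) (x y : E) : Prop :=
  ∃ c l, IsGeodesicPath c l ∧ c 0 = x ∧ c l = y ∧ S = c '' Icc (0:ℝ) l

/-- A geodesic (line): an isometric image of `ℝ`. -/
def IsGeodesicLine {E : Type*} [MetricSpace E] (S : Set E) : Prop :=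
  ∃ c : ℝ → E, Isometry c ∧ S = Set.range c

/-- `E` is a geodesic space: every two points are joined by a geodesic path. -/
def IsGeodesicSpace (E : Type*) [MetricSpace E] : Prop :=
  ∀ x y : E, ∃ S, IsGeodesicSegment S x y

/-- `E` has the geodesic extension property: every geodesic segment is contained
in a geodesic. -/
def GeodesicExtensionProperty (E : Type*) [MetricSpace E] : Prop :=
  ∀ (S : Set E) (x y : E), IsGeodesicSegment S x y → ∃ L, IsGeodesicLine L ∧ S ⊆ L

/-- The metric of `E` is convex. -/
def HasConvexMetric (E : Type*) [MetricSpace E] : Prop :=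
  ∀ (c₁ c₂ : ℝ → E) (l₁ l₂ : ℝ), IsGeodesicPath c₁ l₁ → IsGeodesicPath c₂ l₂ →
    ∀ t ∈ Icc (0:ℝ) 1,
      dist (c₁ (t * l₁)) (c₂ (t * l₂)) ≤
        (1 - t) * dist (c₁ 0) (c₂ 0) + t * dist (c₁ l₁) (c₂ l₂)

/-- A subset `X` is (geodesically) convex: any geodesic segment joining two points
of `X` is contained in `X`. -/
def GeodesicConvex {E : Type*} [MetricSpace E] (X : Set E) : Prop :=
  ∀ x ∈ X, ∀ y ∈ X, ∀ S : Set E, IsGeodesicSegment S x y → S ⊆ X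

/-- A function `f : E → ℝ` is (geodesically) convex. -/
def GeodesicConvexFun {E : Type*} [MetricSpace E] (f : E → ℝ) : Prop :=
  ∀ (c : ℝ → E) (l : ℝ), IsGeodesicPath c l → ∀ t ∈ Icc (0:ℝ) 1,
    f (c (t * l)) ≤ (1 - t) * f (c 0) + t * f (c l)

/-- `G₁(S)`: the union of all geodesic segments with endpoints in `S`. -/
def geodSegUnion {E : Type*} [MetricSpace E] (S : Set E) : Set E :=
  {z | ∃ x ∈ S, ∃ y ∈ S, ∃ T : Set E, IsGeodesicSegment T x y ∧ z ∈ T}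

/-- The iterates `G_n(S)`. -/
def geodGn {E : Type*} [MetricSpace E] (S : Set E) : ℕ → Set E
  | 0 => S
  | n + 1 => geodSegUnion (geodGn S n)

/-- The (geodesic) convex hull `co(S) = ⋃ₙ G_n(S)`. -/
def geodConvexHull {E : Type*} [MetricSpace E] (S : Set E) : Set E :=
  ⋃ n, geodGn S n

/-- `E` is without bifurcating geodesics. -/
def NoBifurcatingGeodesics (E : Type*) [MetricSpace E] : Prop :=
  ∀ (p a b : E) (S₁ S₂ : Set E), IsGeodesicSegment S₁ p a → IsGeodesicSegment S₂ p b →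
    ∀ z, z ∈ S₁ → z ∈ S₂ → z ≠ p → (z = a ∧ z = b) ∨ S₁ ⊆ S₂ ∨ S₂ ⊆ S₁

/-- `E` is reflexive: every descending sequence of nonempty, bounded, closed and convex
subsets of `E` has nonempty intersection. -/
def ReflexiveGeodesicSpace (E : Type*) [MetricSpace E] : Prop :=
  ∀ C : ℕ → Set E, (∀ n, (C n).Nonempty) → (∀ n, IsBounded (C n)) → (∀ n, IsClosed (C n)) →
    (∀ n, GeodesicConvex (C n)) → (∀ n, C (n + 1) ⊆ C n) → (⋂ n, C n).Nonempty

/-- `Dist(x, A)`: the remotal (farthest) distance from `x` to `A`. -/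
def supDist {E : Type*} [MetricSpace E] (x : E) (A : Set E) : ℝ :=
  sSup ((fun a => dist x a) '' A)

/-- `λ_{XY} = inf{ d(x,y) : x ∈ X, y ∈ Y }`. -/
def infSetDist {E : Type*} [MetricSpace E] (X Y : Set E) : ℝ :=
  sInf (Set.image2 dist X Y)

/-- `μ_{XY} = sup{ d(x,y) : x ∈ X, y ∈ Y }`. -/
def supSetDist {E : Type*} [MetricSpace E] (X Y : Set E) : ℝ :=
  sSup (Set.image2 dist X Y)

/-- `L_{XY}(σ) = { x ∈ X : dist(x,Y) ≤ λ_{XY} + σ }`. -/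
def Lset {E : Type*} [MetricSpace E] (X Y : Set E) (σ : ℝ) : Set E :=
  {x ∈ X | infDist x Y ≤ infSetDist X Y + σ}

/-- `M_{XY}(σ) = { x ∈ X : Dist(x,Y) ≥ μ_{XY} − σ }`. -/
def Mset {E : Type*} [MetricSpace E] (X Y : Set E) (σ : ℝ) : Set E :=
  {x ∈ X | supSetDist X Y - σ ≤ supDist x Y}

/-- The minimization problem `min(X,Y)` is well-posed. -/
def MinWellPosed {E : Type*} [MetricSpace E] (X Y : Set E) : Prop :=
  ∃ x₀ ∈ X, ∃ y₀ ∈ Y, dist x₀ y₀ = infSetDist X Y ∧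
    (∀ x ∈ X, ∀ y ∈ Y, dist x y = infSetDist X Y → x = x₀ ∧ y = y₀) ∧
    ∀ x : ℕ → E, ∀ y : ℕ → E, (∀ n, x n ∈ X) → (∀ n, y n ∈ Y) →
      Tendsto (fun n => dist (x n) (y n)) atTop (nhds (infSetDist X Y)) →
      Tendsto x atTop (nhds x₀) ∧ Tendsto y atTop (nhds y₀)

/-- The maximization problem `max(X,Y)` is well-posed. -/
def MaxWellPosed {E : Type*} [MetricSpace E] (X Y : Set E) : Prop :=
  ∃ x₀ ∈ X, ∃ y₀ ∈ Y, dist x₀ y₀ = supSetDist X Y ∧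
    (∀ x ∈ X, ∀ y ∈ Y, dist x y = supSetDist X Y → x = x₀ ∧ y = y₀) ∧
    ∀ x : ℕ → E, ∀ y : ℕ → E, (∀ n, x n ∈ X) → (∀ n, y n ∈ Y) →
      Tendsto (fun n => dist (x n) (y n)) atTop (nhds (supSetDist X Y)) →
      Tendsto x atTop (nhds x₀) ∧ Tendsto y atTop (nhds y₀)

/-- The distance of the model space `M²_κ` (κ < 0): the hyperbolic distance
multiplied by `1/√(-κ)`. -/
def kdist (κ : ℝ) (a b : UpperHalfPlane) : ℝ :=
  (Real.sqrt (-κ))⁻¹ * dist a b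

/-- `pb` is the comparison point in `M²_κ` (relative to the side from `xi` to `xj`,
with comparison vertices `xib`, `xjb`) of a point `p` on a geodesic segment from
`xi` to `xj`. -/
def IsComparisonPoint {E : Type*} [MetricSpace E] (κ : ℝ) (xi xj : E)
    (xib xjb : UpperHalfPlane) (p : E) (pb : UpperHalfPlane) : Prop :=
  kdist κ xib pb = dist xi p ∧ kdist κ pb xjb = dist p xj

/-- `E` has curvature bounded below by `κ < 0`: every geodesic triangle satisfies the
reversed CAT(κ) inequality with respect to any κ-comparison triangle in `M²_κ`. -/
def CurvBoundedBelow (E : Type*) [MetricSpace E] (κ : ℝ) : Prop :=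
  ∀ (x₁ x₂ x₃ : E) (S₁₂ S₂₃ S₁₃ : Set E),
    IsGeodesicSegment S₁₂ x₁ x₂ → IsGeodesicSegment S₂₃ x₂ x₃ → IsGeodesicSegment S₁₃ x₁ x₃ →
    ∀ x₁b x₂b x₃b : UpperHalfPlane,
      kdist κ x₁b x₂b = dist x₁ x₂ → kdist κ x₂b x₃b = dist x₂ x₃ →
      kdist κ x₁b x₃b = dist x₁ x₃ →
      ∀ (p q : E) (pb qb : UpperHalfPlane),
        ((p ∈ S₁₂ ∧ IsComparisonPoint κ x₁ x₂ x₁b x₂b p pb) ∨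
         (p ∈ S₂₃ ∧ IsComparisonPoint κ x₂ x₃ x₂b x₃b p pb) ∨
         (p ∈ S₁₃ ∧ IsComparisonPoint κ x₁ x₃ x₁b x₃b p pb)) →
        ((q ∈ S₁₂ ∧ IsComparisonPoint κ x₁ x₂ x₁b x₂b q qb) ∨
         (q ∈ S₂₃ ∧ IsComparisonPoint κ x₂ x₃ x₂b x₃b q qb) ∨
         (q ∈ S₁₃ ∧ IsComparisonPoint κ x₁ x₃ x₁b x₃b q qb)) →
        kdist κ pb qb ≤ dist p q

/-- Comparison points for Euclidean (κ = 0) comparison triangles in `ℝ²`. -/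
def IsComparisonPointE {E : Type*} [MetricSpace E] (xi xj : E)
    (xib xjb : EuclideanSpace ℝ (Fin 2)) (p : E) (pb : EuclideanSpace ℝ (Fin 2)) : Prop :=
  dist xib pb = dist xi p ∧ dist pb xjb = dist p xj

/-- `E` is a CAT(0) space: a geodesic space where every geodesic triangle satisfies the
CAT(0) comparison inequality with respect to Euclidean comparison triangles. -/
def CATZero (E : Type*) [MetricSpace E] : Prop :=
  IsGeodesicSpace E ∧
  ∀ (x₁ x₂ x₃ : E) (S₁₂ S₂₃ S₁₃ : Set E),
    IsGeodesicSegment S₁₂ x₁ x₂ → IsGeodesicSegment S₂₃ x₂ x₃ → IsGeodesicSegment S₁₃ x₁ x₃ →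
    ∀ x₁b x₂b x₃b : EuclideanSpace ℝ (Fin 2),
      dist x₁b x₂b = dist x₁ x₂ → dist x₂b x₃b = dist x₂ x₃ → dist x₁b x₃b = dist x₁ x₃ →
      ∀ (p q : E) (pb qb : EuclideanSpace ℝ (Fin 2)),
        ((p ∈ S₁₂ ∧ IsComparisonPointE x₁ x₂ x₁b x₂b p pb) ∨
         (p ∈ S₂₃ ∧ IsComparisonPointE x₂ x₃ x₂b x₃b p pb) ∨
         (p ∈ S₁₃ ∧ IsComparisonPointE x₁ x₃ x₁b x₃b p pb)) →
        ((q ∈ S₁₂ ∧ IsComparisonPointE x₁ x₂ x₁b x₂b q qb) ∨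
         (q ∈ S₂₃ ∧ IsComparisonPointE x₂ x₃ x₂b x₃b q qb) ∨
         (q ∈ S₁₃ ∧ IsComparisonPointE x₁ x₃ x₁b x₃b q qb)) →
        dist p q ≤ dist pb qb

/-- The space `P_{b,cl,cv}(E)` of nonempty, bounded, closed and convex subsets of `E`. -/
def Pbclcv (E : Type*) [MetricSpace E] : Type _ :=
  {X : Set E // X.Nonempty ∧ IsBounded X ∧ IsClosed X ∧ GeodesicConvex X}

/-- `P_{b,cl,cv}(E)` carries the Pompeiu-Hausdorff distance. -/
instance Pbclcv.metricSpace (E : Type*) [MetricSpace E] : MetricSpace (Pbclcv E) where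
  dist X Y := hausdorffDist X.1 Y.1
  dist_self X := hausdorffDist_self_zero
  dist_comm X Y := hausdorffDist_comm
  dist_triangle X Y Z := hausdorffDist_triangle
    (hausdorffEdist_ne_top_of_nonempty_of_bounded X.2.1 Y.2.1 X.2.2.1 Y.2.2.1)
  eq_of_dist_eq_zero := by
    intro X Y h
    exact Subtype.ext ((X.2.2.2.1.hausdorffDist_zero_iff_eq Y.2.2.2.1
      (hausdorffEdist_ne_top_of_nonempty_of_bounded X.2.1 Y.2.1 X.2.2.1 Y.2.2.1)).mp h)

/-- `P^A_{b,cl,cv}(E)`: the closure in `(P_{b,cl,cv}(E), h)` of the family of sets at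
positive distance from `A`. -/
def PAbclcv {E : Type*} [MetricSpace E] (A : Set E) : Set (Pbclcv E) :=
  closure {X : Pbclcv E | 0 < infSetDist X.1 A}

/-- The inverse hyperbolic cosine. -/
def arcosh (x : ℝ) : ℝ := Real.log (x + Real.sqrt (x ^ 2 - 1))

/-- The function `F_κ`. -/
def Fkappa (κ d r σ : ℝ) : ℝ :=
  2 / Real.sqrt (-κ) *
    arcosh (Real.cosh (Real.sqrt (-κ) * (r - d + σ)) ^ 2 -
      Real.sinh (Real.sqrt (-κ) * (r - d + σ)) / Real.sinh (Real.sqrt (-κ) * d) *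
        (Real.cosh (Real.sqrt (-κ) * r) -
          Real.cosh (Real.sqrt (-κ) * d) * Real.cosh (Real.sqrt (-κ) * (r - d + σ))))

/-- The petal `P_{α,δ}(x₀, f)`. -/
def petal {E : Type*} [MetricSpace E] (f : E → ℝ) (α δ : ℝ) (x₀ : E) : Set E :=
  {x | f x ≤ f x₀ - α * dist x x₀ + δ}

/-- `L_{A,f}(σ)`. -/
def LsetFun {E : Type*} [MetricSpace E] (A : Set E) (f : E → ℝ) (σ : ℝ) : Set E :=
  {x | f x ≤ sInf (f '' A) + σ ∧ infDist x A ≤ σ}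

/-- The problem `min(A,f)` is well-posed in the sense of Revalski. -/
def RevalskiWellPosed {E : Type*} [MetricSpace E] (A : Set E) (f : E → ℝ) : Prop :=
  sInf ((fun σ => diam (LsetFun A f σ)) '' Ioi 0) = 0

/-- The nearest point problem `min(X,y)` is well-posed. -/
def PointMinWellPosed {E : Type*} [MetricSpace E] (X : Set E) (y : E) : Prop :=
  ∃ x₀ ∈ X, dist x₀ y = infDist y X ∧ (∀ x ∈ X, dist x y = infDist y X → x = x₀) ∧
    ∀ x : ℕ → E, (∀ n, x n ∈ X) →
      Tendsto (fun n => dist (x n) y) atTop (nhds (infDist y X)) →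
      Tendsto x atTop (nhds x₀)

end

theorem isGeodesicPath_const {E : Type*} [MetricSpace E] (p : E) :
    IsGeodesicPath (fun _ : ℝ => p) 0 := by
  refine ⟨le_rfl, fun s hs t ht => ?_⟩
  have h₁ : s = 0 := le_antisymm hs.2 hs.1
  have h₂ : t = 0 := le_antisymm ht.2 ht.1
  simp [h₁, h₂]

theorem HasConvexMetric.geodesicConvexFun_dist {E : Type*} [MetricSpace E]
    (hconv : HasConvexMetric E) (p : E) : GeodesicConvexFun (fun z => dist z p) :=
  fun c l hc t ht => hconv c (fun _ => p) l 0 hc (isGeodesicPath_const p) t ht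

theorem HasConvexMetric.geodesicConvexFun_infDist {E : Type*} [MetricSpace E]
    (hgeo : IsGeodesicSpace E) (hconv : HasConvexMetric E) {X : Set E} (hX : X.Nonempty)
    (hXcv : GeodesicConvex X) : GeodesicConvexFun (fun z => infDist z X) := by
  intro c l hc t ht
  refine le_of_forall_pos_le_add fun δ hδ => ?_
  obtain ⟨x, hx, hxδ⟩ := (infDist_lt_iff hX).1 (lt_add_of_pos_right (infDist (c 0) X) hδ)
  obtain ⟨y, hy, hyδ⟩ := (infDist_lt_iff hX).1 (lt_add_of_pos_right (infDist (c l) X) hδ)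
  obtain ⟨S, hS⟩ := hgeo x y
  have hSX := hXcv x hx y hy S hS
  obtain ⟨c', l', hc', rfl, rfl, rfl⟩ := hS
  have hmem : c' (t * l') ∈ X := hSX <| mem_image_of_mem c'
    ⟨mul_nonneg ht.1 hc'.1, mul_le_of_le_one_left hc'.1 ht.2⟩
  calc infDist (c (t * l)) X ≤ dist (c (t * l)) (c' (t * l')) := infDist_le_dist_of_mem hmem
    _ ≤ (1 - t) * dist (c 0) (c' 0) + t * dist (c l) (c' l') := hconv c c' l l' hc hc' t ht
    _ ≤ (1 - t) * (infDist (c 0) X + δ) + t * (infDist (c l) X + δ) := by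
      have h := sub_nonneg.2 ht.2
      have h' := ht.1
      gcongr
    _ = (1 - t) * infDist (c 0) X + t * infDist (c l) X + δ := by ring

theorem GeodesicConvexFun.add {E : Type*} [MetricSpace E] {f g : E → ℝ}
    (hf : GeodesicConvexFun f) (hg : GeodesicConvexFun g) :
    GeodesicConvexFun (fun z => f z + g z) := by
  intro c l hc t ht
  linarith [hf c l hc t ht, hg c l hc t ht]

theorem GeodesicConvexFun.const_mul {E : Type*} [MetricSpace E] {f : E → ℝ}
    (hf : GeodesicConvexFun f) {a : ℝ} (ha : 0 ≤ a) : GeodesicConvexFun (fun z => a * f z) := by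
  intro c l hc t ht
  linarith [mul_le_mul_of_nonneg_left (hf c l hc t ht) ha]

/-- A convex function bounded above on `S` has the same bound on the convex hull of `S`. -/
theorem GeodesicConvexFun.le_of_mem_geodConvexHull {E : Type*} [MetricSpace E] {f : E → ℝ}
    (hf : GeodesicConvexFun f) {S : Set E} {M : ℝ} (hS : ∀ z ∈ S, f z ≤ M) :
    ∀ z ∈ geodConvexHull S, f z ≤ M := by
  have key : ∀ n, ∀ z ∈ geodGn S n, f z ≤ M := by
    intro n
    induction n with
    | zero => exact hS
    | succ n ih =>
      rintro z ⟨x, hx, y, hy, T, ⟨c, l, hc, rfl, rfl, rfl⟩, s, hs, rfl⟩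
      rcases hc.1.eq_or_lt with hl | hl
      · have : s = 0 := le_antisymm (hl ▸ hs.2) hs.1
        exact this ▸ ih _ hx
      · have ht : s / l ∈ Icc (0 : ℝ) 1 := ⟨div_nonneg hs.1 hl.le, (div_le_one hl).2 hs.2⟩
        have h := hf c l hc (s / l) ht
        rw [div_mul_cancel₀ s hl.ne'] at h
        nlinarith [mul_le_mul_of_nonneg_left (ih _ hx) (sub_nonneg.2 ht.2),
          mul_le_mul_of_nonneg_left (ih _ hy) ht.1]
  intro z hz
  obtain ⟨n, hn⟩ := mem_iUnion.1 hz
  exact key n z hn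

/-- Points of the closed convex hull of `X ∪ {p}` almost as far from `X` as `p` are close
to `p`. -/
theorem dist_le_of_mem_closure_geodConvexHull {E : Type*} [MetricSpace E]
    (hgeo : IsGeodesicSpace E) (hconv : HasConvexMetric E) {X : Set E} (hX : X.Nonempty)
    (hXb : IsBounded X) (hXcv : GeodesicConvex X) {r : ℝ} (hr : 0 < r) {p : E}
    (hp : r ≤ infDist p X) {z : E} (hz : z ∈ closure (geodConvexHull (X ∪ {p}))) :
    dist z p ≤ (1 + diam X / r) * (infDist p X - infDist z X) := by
  have hK : 0 ≤ 1 + diam X / r := add_nonneg zero_le_one (div_nonneg diam_nonneg hr.le)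
  have hfun := (hconv.geodesicConvexFun_dist p).add
    ((hconv.geodesicConvexFun_infDist hgeo hX hXcv).const_mul hK)
  have hS : ∀ w ∈ X ∪ {p},
      dist w p + (1 + diam X / r) * infDist w X ≤ (1 + diam X / r) * infDist p X := by
    rintro w (hw | rfl)
    · have h₁ : dist p w ≤ infDist p X + diam X := dist_le_infDist_add_diam hXb hw
      have h₂ : diam X ≤ diam X / r * infDist p X := by
        calc diam X = diam X / r * r := (div_mul_cancel₀ _ hr.ne').symm
          _ ≤ diam X / r * infDist p X :=
            mul_le_mul_of_nonneg_left hp (div_nonneg diam_nonneg hr.le)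
      rw [infDist_zero_of_mem hw, dist_comm]
      linarith
    · simp
  have hcl : IsClosed {w : E |
      dist w p + (1 + diam X / r) * infDist w X ≤ (1 + diam X / r) * infDist p X} :=
    isClosed_le ((continuous_id.dist continuous_const).add
      (continuous_const.mul (continuous_infDist_pt X))) continuous_const
  have h : dist z p + (1 + diam X / r) * infDist z X ≤ (1 + diam X / r) * infDist p X :=
    hcl.closure_subset_iff.2 (hfun.le_of_mem_geodConvexHull hS) hz
  linarith

/-- the diameters of the sets `C_n` tend to `0` uniformly in `x'`
with `dist(x',X) ≥ r`. -/
theorem statement4 {E : Type*} [MetricSpace E] (hgeo : IsGeodesicSpace E)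
    (hconv : HasConvexMetric E) (X : Set E) (hX : X.Nonempty) (hXb : IsBounded X)
    (hXcv : GeodesicConvex X) :
    ∀ r > (0:ℝ), ∀ ε > (0:ℝ), ∃ n₀ : ℕ, ∀ n ≥ n₀, ∀ x' : E, r ≤ infDist x' X →
      diam (closure (geodConvexHull (X ∪ {x'})) \
        ⋃ x ∈ X, ball x (infDist x' X - 1 / (n : ℝ))) < ε := by
  intro r hr ε hε
  have hK : 0 < 1 + diam X / r := add_pos_of_pos_of_nonneg one_pos (div_nonneg diam_nonneg hr.le)
  obtain ⟨n₀, hn₀⟩ := exists_nat_gt (2 * (1 + diam X / r) / ε)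
  refine ⟨n₀, fun n hn p hp => ?_⟩
  have hn' : 2 * (1 + diam X / r) / ε < n := hn₀.trans_le (by exact_mod_cast hn)
  have hnpos : (0 : ℝ) < n := lt_of_le_of_lt (by positivity) hn'
  have hlt : 2 * ((1 + diam X / r) * (1 / (n : ℝ))) < ε := by
    rw [div_lt_iff₀ hε] at hn'
    rw [mul_one_div, ← mul_div_assoc, div_lt_iff₀ hnpos]
    linarith
  have hclose : ∀ z ∈ closure (geodConvexHull (X ∪ {p})) \
      ⋃ x ∈ X, ball x (infDist p X - 1 / (n : ℝ)),
      dist z p ≤ (1 + diam X / r) * (1 / (n : ℝ)) := by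
    rintro z ⟨hz, hzn⟩
    refine (dist_le_of_mem_closure_geodConvexHull hgeo hconv hX hXb hXcv hr hp hz).trans ?_
    have hfar : infDist p X - 1 / (n : ℝ) ≤ infDist z X := by
      refine (le_infDist hX).2 fun {x} hx => ?_
      by_contra! h
      exact hzn (mem_biUnion hx h)
    gcongr
    linarith
  refine lt_of_le_of_lt (diam_le_of_forall_dist_le (by positivity) fun a ha b hb => ?_) hlt
  linarith [dist_triangle_right a b p, hclose a ha, hclose b hb]
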